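/- arXiv:1505.03197 — 2 statements merged into one kernel-verified Lean document; each statement's English description precedes it below -/
import Mathlib

section
/- Let a > 0 and let f(x) = 1 − 4/x. Let n be a positive integer and let C be a real number with C ≥ n·a. Then for all real numbers x₁, …, xₙ with xᵢ ≥ a for each i and x₁ + ⋯ + xₙ = C, one has f(x₁) + ⋯ + f(xₙ) ≥ (n − 1)·f(a) + f(C − a(n − 1)); that is, subject to these constraints, the minimum value of Σᵢ f(xᵢ) is achieved when x₁ = ⋯ = x_{n−1} = a and xₙ = C − a(n − 1). -/
/-- On `[a, b]` the convex function `x ↦ 1 / x` lies below its chord. -/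
theorem inv_le_chord {a b x : ℝ} (ha : 0 < a) (hax : a ≤ x) (hxb : x ≤ b) :
    1 / x ≤ (a + b - x) / (a * b) := by
  have hx : 0 < x := ha.trans_le hax
  have hb : 0 < b := hx.trans_le hxb
  rw [div_le_div_iff₀ hx (mul_pos ha hb)]
  nlinarith [mul_nonneg (sub_nonneg.2 hax) (sub_nonneg.2 hxb)]

/-- **Concavity Lemma.**  Let `f(x) = 1 − 4/x` on `[a, ∞)` with `a > 0`.  Subject to
`xᵢ ≥ a` for all `i` and `x₁ + ⋯ + xₙ = C`, the minimum of `Σᵢ f(xᵢ)` is attained when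
`x₁ = ⋯ = x_{n−1} = a` and `xₙ = C − a(n − 1)`. -/
theorem concavity_lemma (a : ℝ) (ha : 0 < a) (n : ℕ) (hn : 0 < n) (C : ℝ)
    (hC : (n : ℝ) * a ≤ C) (x : Fin n → ℝ) (hx : ∀ i, a ≤ x i)
    (hsum : ∑ i, x i = C) :
    ((n : ℝ) - 1) * (1 - 4 / a) + (1 - 4 / (C - a * ((n : ℝ) - 1)))
      ≤ ∑ i, (1 - 4 / x i) := by
  obtain ⟨M, hM⟩ : ∃ M, M = C - a * ((n : ℝ) - 1) := ⟨_, rfl⟩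
  have haM : a ≤ M := by linarith
  have hM0 : 0 < M := ha.trans_le haM
  have hxM : ∀ i, x i ≤ M := by
    intro i
    have h := Finset.single_le_sum (f := fun j => x j - a)
      (fun j _ => sub_nonneg.2 (hx j)) (Finset.mem_univ i)
    simp only [Finset.sum_sub_distrib, hsum, Finset.sum_const, Finset.card_univ,
      Fintype.card_fin, nsmul_eq_mul] at h
    linarith
  rw [← hM]
  calc ((n : ℝ) - 1) * (1 - 4 / a) + (1 - 4 / M)
      = ∑ i, (1 - 4 * ((a + M - x i) / (a * M))) := by
        simp only [Finset.sum_sub_distrib, ← Finset.mul_sum, ← Finset.sum_div, hsum,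
          Finset.sum_const, Finset.card_univ, Fintype.card_fin, nsmul_eq_mul]
        have hC' : C = M + a * ((n : ℝ) - 1) := by linarith
        rw [hC']
        field_simp
        ring
    _ ≤ ∑ i, (1 - 4 / x i) := by
        refine Finset.sum_le_sum fun i _ => ?_
        have h := inv_le_chord ha (hx i) (hxM i)
        rw [div_eq_mul_one_div 4 (x i)]
        linarith
end

section
/- Let a > 0 and let f(x) = 1 − 4/x. Then for all real numbers x₁, x₂ with x₁ ≥ a and x₂ ≥ a, one has f(x₁) + f(x₂) ≥ f(a) + f(x₁ + x₂ − a). -/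
/-- The two-variable inequality behind the Concavity Lemma: for `f(x) = 1 − 4/x` on
`[a, ∞)` with `a > 0`, we have `f(x₁) + f(x₂) ≥ f(a) + f(x₁ + x₂ − a)`. -/
theorem concavity_two_var (a : ℝ) (ha : 0 < a) (x₁ x₂ : ℝ)
    (h1 : a ≤ x₁) (h2 : a ≤ x₂) :
    (1 - 4 / a) + (1 - 4 / (x₁ + x₂ - a)) ≤ (1 - 4 / x₁) + (1 - 4 / x₂) := by
  have hx₁ : 0 < x₁ := ha.trans_le h1
  have hx₂ : 0 < x₂ := ha.trans_le h2
  have hs : 0 < x₁ + x₂ - a := by linarith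
  have hprod : a * (x₁ + x₂ - a) ≤ x₁ * x₂ := by
    linarith [mul_nonneg (sub_nonneg.2 h1) (sub_nonneg.2 h2)]
  have key : 4 / x₁ + 4 / x₂ ≤ 4 / a + 4 / (x₁ + x₂ - a) :=
    calc 4 / x₁ + 4 / x₂ = 4 * (x₁ + x₂) / (x₁ * x₂) := by field_simp; ring
      _ ≤ 4 * (x₁ + x₂) / (a * (x₁ + x₂ - a)) := by gcongr
      _ = 4 / a + 4 / (x₁ + x₂ - a) := by field_simp; ring
  linarith
end
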